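/- Let (P, 𝓛) be a thick polar space of rank at least 3 in which every line contains at least 4 points. Let L₁, L₂ ∈ 𝓛 and let S be the set of lines opposite both L₁ and L₂. Then S is connected under the line-adjacency relation: for all J, J' ∈ S there exist n ∈ ℕ and lines J = J₀, J₁, …, J_n = J' in S such that for every i < n the lines Jᵢ and Jᵢ₊₁ are distinct, share a point, and every point of Jᵢ is collinear with every point of Jᵢ₊₁ (so they span a common singular plane). -/

import Mathlib

/-- Two points of a point-line geometry `(P, 𝓛)` are collinear if some line contains both. -/
def GeomCollinear {P : Type*} (𝓛 : Set (Set P)) (p q : P) : Prop :=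
  ∃ l ∈ 𝓛, p ∈ l ∧ q ∈ l

/-- Two lines are opposite if no point of either of them is collinear with every point of
the other. -/
def OppositeLines {P : Type*} (𝓛 : Set (Set P)) (J L : Set P) : Prop :=
  (∀ p ∈ J, ¬ ∀ q ∈ L, GeomCollinear 𝓛 p q) ∧ (∀ p ∈ L, ¬ ∀ q ∈ J, GeomCollinear 𝓛 p q)

/-- A nondegenerate polar space, presented by its collinearity relation `r` and its set of
lines `𝓛`, in which every line has at least four points. The rank is at least two because
`refl` and `join` put every point on a line. -/
structure IsPolarSpace {P : Type*} (r : P → P → Prop) (𝓛 : Set (Set P)) : Prop where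
  refl : ∀ x, r x x
  symm : ∀ {x y}, r x y → r y x
  mem : ∀ {l}, l ∈ 𝓛 → ∀ {x y}, x ∈ l → y ∈ l → r x y
  join : ∀ {x y}, r x y → ∃ l ∈ 𝓛, x ∈ l ∧ y ∈ l
  meet : ∀ {l}, l ∈ 𝓛 → ∀ x, ∃ q ∈ l, r x q
  all : ∀ {l}, l ∈ 𝓛 → ∀ {x p q s}, p ∈ l → q ∈ l → p ≠ q → r x p → r x q → s ∈ l → r x s
  fourth : ∀ {l}, l ∈ 𝓛 → ∀ a b c, ∃ d ∈ l, d ≠ a ∧ d ≠ b ∧ d ≠ c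
  nondeg : ∀ x, ∃ y, ¬ r x y

namespace IsPolarSpace

variable {P : Type*} {r : P → P → Prop} {𝓛 : Set (Set P)}

/-- A point of a line not in `x^⊥` is determined by its collinearity with `x`. -/
theorem eq_of_rel (h : IsPolarSpace r 𝓛) {l : Set P} (hl : l ∈ 𝓛) {x p q s : P}
    (hp : p ∈ l) (hq : q ∈ l) (hs : s ∈ l) (hxs : ¬ r x s) (hxp : r x p) (hxq : r x q) :
    p = q := by
  by_contra hne
  exact hxs (h.all hl hp hq hne hxp hxq hs)

/-- In a nondegenerate polar space, `x^⊥ ⊆ y^⊥` only if `x = y`. -/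
theorem exists_rel_not_rel (h : IsPolarSpace r 𝓛) {x y : P} (hxy : x ≠ y) :
    ∃ z, r x z ∧ ¬ r y z := by
  by_contra! hsub
  obtain ⟨l, hl, hxl, hyl⟩ := h.join (h.symm (hsub x (h.refl x)))
  have key : ∀ z u, ¬ r y z → u ∈ l → r z u → ∀ w, r z w → r u w := by
    intro z u hyz hul hzu w hzw
    obtain ⟨n, hn, hzn, hwn⟩ := h.join hzw
    obtain ⟨v, hvn, hxv⟩ := h.meet hn x
    have hyv := hsub v hxv
    have hvu : r v u := h.all hl hxl hyl hxy (h.symm hxv) (h.symm hyv) hul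
    have hvz : v ≠ z := by rintro rfl; exact hyz hyv
    exact h.all hn hvn hzn hvz (h.symm hvu) (h.symm hzu) hwn
  obtain ⟨z, hyz⟩ := h.nondeg y
  obtain ⟨u, hul, hzu⟩ := h.meet hl z
  obtain ⟨s, hus⟩ := h.nondeg u
  have hyu : r y u := h.mem hl hyl hul
  obtain ⟨k, hk, hzk, huk⟩ := h.join hzu
  obtain ⟨t, htk, hst⟩ := h.meet hk s
  have htu : t ≠ u := by rintro rfl; exact hus (h.symm hst)
  have hyt : ¬ r y t := fun hyt => hyz (h.all hk htk huk htu hyt hyu hzk)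
  have main : ∀ s, ¬ r u s → r s t → r y s := by
    intro s hus hst
    by_contra hys
    obtain ⟨v, hvl, hsv⟩ := h.meet hl s
    have hvt := key s v hys hvl hsv t hst
    have huv : u ≠ v := by rintro rfl; exact hus (h.symm hsv)
    exact hyt (h.symm (h.all hl hul hvl huv (h.mem hk htk huk) (h.symm hvt) hyl))
  have hys := main s hus hst
  obtain ⟨n, hn, hsn, htn⟩ := h.join hst
  obtain ⟨d, hdn, hds, hdt, -⟩ := h.fourth hn s t t
  have hut : r u t := h.mem hk huk htk
  have hud : ¬ r u d := fun hud => hus (h.all hn hdn htn hdt hud hut hsn)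
  exact hyt (h.all hn hdn hsn hds (main d hud (h.mem hn hdn htn)) hys htn)

theorem exists_not_rel_of_two (h : IsPolarSpace r 𝓛) {u x₁ x₂ : P} (h₁ : ¬ r x₁ u)
    (h₂ : ¬ r x₂ u) (x₃ : P) : ∃ v, ¬ r x₁ v ∧ ¬ r x₂ v ∧ ¬ r x₃ v := by
  have aux : ∃ w, w ≠ x₃ ∧ ¬ r x₁ w ∧ ¬ r x₂ w := by
    obtain ⟨n, hn, hun, -⟩ := h.join (h.refl u)
    obtain ⟨d₁, hd₁, hr₁⟩ := h.meet hn x₁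
    obtain ⟨d₂, hd₂, hr₂⟩ := h.meet hn x₂
    obtain ⟨w, hw, hw₁, hw₂, hw₃⟩ := h.fourth hn d₁ d₂ x₃
    exact ⟨w, hw₃, fun hr => hw₁ (h.eq_of_rel hn hw hd₁ hun h₁ hr hr₁),
      fun hr => hw₂ (h.eq_of_rel hn hw hd₂ hun h₂ hr hr₂)⟩
  obtain ⟨w, hw, hw₁, hw₂⟩ := aux
  obtain ⟨z, hwz, hz⟩ := h.exists_rel_not_rel hw
  obtain ⟨n, hn, hwn, hzn⟩ := h.join hwz
  obtain ⟨d₁, hd₁, hr₁⟩ := h.meet hn x₁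
  obtain ⟨d₂, hd₂, hr₂⟩ := h.meet hn x₂
  obtain ⟨d₃, hd₃, hr₃⟩ := h.meet hn x₃
  obtain ⟨v, hv, hv₁, hv₂, hv₃⟩ := h.fourth hn d₁ d₂ d₃
  exact ⟨v, fun hr => hv₁ (h.eq_of_rel hn hv hd₁ hwn hw₁ hr hr₁),
    fun hr => hv₂ (h.eq_of_rel hn hv hd₂ hwn hw₂ hr hr₂),
    fun hr => hv₃ (h.eq_of_rel hn hv hd₃ hzn hz hr hr₃)⟩

/-- Three point-perps do not cover the point set. -/
theorem exists_not_rel_three (h : IsPolarSpace r 𝓛) (x₁ x₂ x₃ : P) :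
    ∃ v, ¬ r x₁ v ∧ ¬ r x₂ v ∧ ¬ r x₃ v := by
  obtain ⟨u, hu⟩ := h.nondeg x₁
  obtain ⟨w, hw₁, -, hw₂⟩ := h.exists_not_rel_of_two hu hu x₂
  exact h.exists_not_rel_of_two hw₁ hw₂ x₃

end IsPolarSpace

/-- Distinct collinear points, neither of them collinear with `x₁` or `x₂`. -/
def FarAdj {P : Type*} (r : P → P → Prop) (x₁ x₂ a b : P) : Prop :=
  a ≠ b ∧ r a b ∧ (¬ r x₁ a ∧ ¬ r x₂ a) ∧ (¬ r x₁ b ∧ ¬ r x₂ b)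

theorem FarAdj.reflTransGen_of_rel {P : Type*} {r : P → P → Prop} {x₁ x₂ a b : P} (hab : r a b)
    (ha : ¬ r x₁ a ∧ ¬ r x₂ a) (hb : ¬ r x₁ b ∧ ¬ r x₂ b) :
    Relation.ReflTransGen (FarAdj r x₁ x₂) a b := by
  by_cases hne : a = b
  · rw [hne]
  · exact Relation.ReflTransGen.single ⟨hne, hab, ha, hb⟩

namespace IsPolarSpace

variable {P : Type*} {r : P → P → Prop} {𝓛 : Set (Set P)}

theorem farAdj_symm (h : IsPolarSpace r 𝓛) {x₁ x₂ a b : P}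
    (hab : Relation.ReflTransGen (FarAdj r x₁ x₂) a b) :
    Relation.ReflTransGen (FarAdj r x₁ x₂) b a := by
  induction hab with
  | refl => exact .refl
  | tail _ hyz ih => exact ih.head ⟨hyz.1.symm, h.symm hyz.2.1, hyz.2.2.2, hyz.2.2.1⟩

/-- A point far from `x₁, x₂` which has a common neighbour with them is connected to every
point far from `x₁, x₂`. -/
theorem farAdj_of_common (h : IsPolarSpace r 𝓛) {x₁ x₂ a b u : P}
    (ha : ¬ r x₁ a ∧ ¬ r x₂ a) (hb : ¬ r x₁ b ∧ ¬ r x₂ b)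
    (hau : r a u) (hu₁ : r x₁ u) (hu₂ : r x₂ u) :
    Relation.ReflTransGen (FarAdj r x₁ x₂) a b := by
  by_contra hcon
  have hab : ¬ r a b := fun hab => hcon (FarAdj.reflTransGen_of_rel hab ha hb)
  obtain ⟨l, hl, hal, hul⟩ := h.join hau
  obtain ⟨c, hcl, hbc⟩ := h.meet hl b
  have hbc' : b ≠ c := by rintro rfl; exact hab (h.mem hl hal hcl)
  obtain ⟨w, hbw, hcw⟩ := h.exists_rel_not_rel hbc'
  obtain ⟨m, hm, hbm, hwm⟩ := h.join hbw
  obtain ⟨d₁, hd₁, hr₁⟩ := h.meet hm x₁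
  obtain ⟨d₂, hd₂, hr₂⟩ := h.meet hm x₂
  have hbad : ∀ y ∈ l, y ≠ u → r y d₁ ∨ r y d₂ := by
    intro y hy hyu
    have hyg : ¬ r x₁ y ∧ ¬ r x₂ y :=
      ⟨fun hr => hyu (h.eq_of_rel hl hy hul hal ha.1 hr hu₁),
        fun hr => hyu (h.eq_of_rel hl hy hul hal ha.2 hr hu₂)⟩
    obtain ⟨z, hz, hyz⟩ := h.meet hm y
    by_cases hz₁ : r x₁ z
    · left; rwa [h.eq_of_rel hm hd₁ hz hbm hb.1 hr₁ hz₁]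
    by_cases hz₂ : r x₂ z
    · right; rwa [h.eq_of_rel hm hd₂ hz hbm hb.2 hr₂ hz₂]
    exact absurd (((FarAdj.reflTransGen_of_rel (h.mem hl hal hy) ha hyg).trans
      (FarAdj.reflTransGen_of_rel hyz hyg ⟨hz₁, hz₂⟩)).trans
      (FarAdj.reflTransGen_of_rel (h.mem hm hz hbm) ⟨hz₁, hz₂⟩ hb)) hcon
  have huniq : ∀ d ∈ m, b ≠ d → ∀ y ∈ l, ∀ z ∈ l, y ≠ z → r y d → r z d → False := by
    intro d hd hbd y hy z hz hyz hyd hzd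
    have hdc : r d c := h.all hl hy hz hyz (h.symm hyd) (h.symm hzd) hcl
    exact hcw (h.all hm hbm hd hbd (h.symm hbc) (h.symm hdc) hwm)
  have hbd₁ : b ≠ d₁ := by rintro rfl; exact hb.1 hr₁
  have hbd₂ : b ≠ d₂ := by rintro rfl; exact hb.2 hr₂
  obtain ⟨y₁, hy₁, hy₁u, -, -⟩ := h.fourth hl u u u
  obtain ⟨y₂, hy₂, hy₂u, hy₂₁, -⟩ := h.fourth hl u y₁ y₁
  obtain ⟨y₃, hy₃, hy₃u, hy₃₁, hy₃₂⟩ := h.fourth hl u y₁ y₂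
  have u₁ := huniq d₁ hd₁ hbd₁
  have u₂ := huniq d₂ hd₂ hbd₂
  rcases hbad y₁ hy₁ hy₁u with k₁ | k₁ <;> rcases hbad y₂ hy₂ hy₂u with k₂ | k₂ <;>
    rcases hbad y₃ hy₃ hy₃u with k₃ | k₃
  · exact u₁ _ hy₂ _ hy₁ hy₂₁ k₂ k₁
  · exact u₁ _ hy₂ _ hy₁ hy₂₁ k₂ k₁
  · exact u₁ _ hy₃ _ hy₁ hy₃₁ k₃ k₁
  · exact u₂ _ hy₃ _ hy₂ hy₃₂ k₃ k₂
  · exact u₁ _ hy₃ _ hy₂ hy₃₂ k₃ k₂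
  · exact u₂ _ hy₃ _ hy₁ hy₃₁ k₃ k₁
  · exact u₂ _ hy₂ _ hy₁ hy₂₁ k₂ k₁
  · exact u₂ _ hy₂ _ hy₁ hy₂₁ k₂ k₁

/-- Two far points with a common neighbour in `x₁^⊥` are connected. -/
theorem farAdj_of_common_left (h : IsPolarSpace r 𝓛) {x₁ x₂ a b c : P}
    (ha : ¬ r x₁ a ∧ ¬ r x₂ a) (hb : ¬ r x₁ b ∧ ¬ r x₂ b) (hx : ¬ r x₁ x₂)
    (hac : r a c) (hbc : r b c) (hc₁ : r x₁ c) :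
    Relation.ReflTransGen (FarAdj r x₁ x₂) a b := by
  by_cases hab : r a b
  · exact FarAdj.reflTransGen_of_rel hab ha hb
  by_cases hc₂ : r x₂ c
  · exact h.farAdj_of_common ha hb hac hc₁ hc₂
  obtain ⟨l, hl, hal, hcl⟩ := h.join hac
  obtain ⟨m, hm, hbm, hcm⟩ := h.join hbc
  obtain ⟨a₂, ha₂, hxa₂⟩ := h.meet hl x₂
  obtain ⟨n, hn, hxn, han⟩ := h.join hxa₂
  obtain ⟨g, hgn, hg₁⟩ := h.meet hn x₁
  have hg₂ : r x₂ g := h.mem hn hxn hgn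
  obtain ⟨g', hg'm, hgg'⟩ := h.meet hm g
  have ha₂c : a₂ ≠ c := by rintro rfl; exact hc₂ hxa₂
  by_cases hg'₁ : r x₁ g'
  · have hg'c : g' = c := h.eq_of_rel hm hg'm hcm hbm hb.1 hg'₁ hc₁
    subst hg'c
    have hga : r g a := h.all hl ha₂ hcl ha₂c (h.mem hn hgn han) hgg' hal
    exact h.farAdj_of_common ha hb (h.symm hga) hg₁ hg₂
  by_cases hg'₂ : r x₂ g'
  · exfalso
    have hgx : g ≠ x₂ := by rintro rfl; exact hx hg₁
    have hg'a₂ : r g' a₂ := h.all hn hgn hxn hgx (h.symm hgg') (h.symm hg'₂) han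
    have hg'c : g' ≠ c := by rintro rfl; exact hc₂ hg'₂
    have hba₂ : r a₂ b := h.all hm hg'm hcm hg'c (h.symm hg'a₂) (h.mem hl ha₂ hcl) hbm
    exact hab (h.symm (h.all hl ha₂ hcl ha₂c (h.symm hba₂) hbc hal))
  · exact (h.farAdj_symm (h.farAdj_of_common ⟨hg'₁, hg'₂⟩ ha (h.symm hgg') hg₁ hg₂)).trans
      (h.farAdj_of_common ⟨hg'₁, hg'₂⟩ hb (h.symm hgg') hg₁ hg₂)

/-- The points collinear with neither of two given points are connected. -/
theorem farAdj_connected (h : IsPolarSpace r 𝓛) {x₁ x₂ a b : P}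
    (ha : ¬ r x₁ a ∧ ¬ r x₂ a) (hb : ¬ r x₁ b ∧ ¬ r x₂ b) :
    Relation.ReflTransGen (FarAdj r x₁ x₂) a b := by
  by_cases hx : r x₁ x₂
  · obtain ⟨l, hl, hl₁, hl₂⟩ := h.join hx
    obtain ⟨u, hu, hau⟩ := h.meet hl a
    exact h.farAdj_of_common ha hb hau (h.mem hl hl₁ hu) (h.mem hl hl₂ hu)
  obtain ⟨l, hl, hal, -⟩ := h.join (h.refl a)
  obtain ⟨c, hcl, hbc⟩ := h.meet hl b
  have hac := h.mem hl hal hcl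
  by_cases hc₁ : r x₁ c
  · exact h.farAdj_of_common_left ha hb hx hac hbc hc₁
  by_cases hc₂ : r x₂ c
  · have := h.farAdj_of_common_left ha.symm hb.symm (fun hr => hx (h.symm hr)) hac hbc hc₂
    exact Relation.ReflTransGen.mono (fun _ _ hyz => ⟨hyz.1, hyz.2.1, hyz.2.2.1.symm,
      hyz.2.2.2.symm⟩) _ _ this
  exact (FarAdj.reflTransGen_of_rel hac ha ⟨hc₁, hc₂⟩).trans
    (FarAdj.reflTransGen_of_rel (h.symm hbc) ⟨hc₁, hc₂⟩ hb)

/-- Projecting a line through `p` into `q^⊥`. -/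
theorem exists_projection (h : IsPolarSpace r 𝓛) {p q s : P} (hpq : ¬ r p q) (hps : r p s)
    (hne : s ≠ p) : ∃ x, r p x ∧ r q x ∧ ∀ v, r p v → (r x v ↔ r s v) := by
  obtain ⟨l, hl, hpl, hsl⟩ := h.join hps
  obtain ⟨x, hxl, hqx⟩ := h.meet hl q
  have hxp : x ≠ p := by rintro rfl; exact hpq (h.symm hqx)
  refine ⟨x, h.mem hl hpl hxl, hqx, fun v hv => ⟨fun hr => ?_, fun hr => ?_⟩⟩
  · exact h.symm (h.all hl hxl hpl hxp (h.symm hr) (h.symm hv) hsl)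
  · exact h.symm (h.all hl hsl hpl hne (h.symm hr) (h.symm hv) hxl)

/-- For noncollinear points `p, q` of a polar space of rank at least three, `p^⊥ ∩ q^⊥` is a
polar space. -/
theorem perp_inter (h : IsPolarSpace r 𝓛)
    (hunique : ∀ p q : P, p ≠ q → ∀ l₁ ∈ 𝓛, ∀ l₂ ∈ 𝓛,
      p ∈ l₁ → q ∈ l₁ → p ∈ l₂ → q ∈ l₂ → l₁ = l₂)
    (hrank : ∀ l ∈ 𝓛, ∃ p : P, p ∉ l ∧ ∀ q ∈ l, r p q) {p q : P} (hpq : ¬ r p q) :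
    IsPolarSpace (fun x y : {x : P // r p x ∧ r q x} => r x y)
      {l | ∃ m ∈ 𝓛, (∀ x ∈ m, r p x ∧ r q x) ∧ l = Subtype.val ⁻¹' m} := by
  have join_ne : ∀ x y : {x : P // r p x ∧ r q x}, x ≠ y → r x y →
      ∃ m ∈ 𝓛, (∀ z ∈ m, r p z ∧ r q z) ∧ (x : P) ∈ m ∧ (y : P) ∈ m := by
    intro x y hne hxy
    obtain ⟨m, hm, hxm, hym⟩ := h.join hxy
    have hne' : (x : P) ≠ y := fun e => hne (Subtype.ext e)
    exact ⟨m, hm, fun z hz => ⟨h.all hm hxm hym hne' x.2.1 y.2.1 hz,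
      h.all hm hxm hym hne' x.2.2 y.2.2 hz⟩, hxm, hym⟩
  refine ⟨fun x => h.refl _, fun hxy => h.symm hxy, ?_, ?_, ?_, ?_, ?_, ?_⟩
  · rintro _ ⟨m, hm, -, rfl⟩ x y hx hy
    exact h.mem hm hx hy
  · intro x y hxy
    by_cases hne : x = y
    · subst hne
      have hxp : (x : P) ≠ p := fun e => hpq (h.symm (e ▸ x.2.2))
      obtain ⟨m, hm, hpm, hxm⟩ := h.join x.2.1
      obtain ⟨s, hsm, hs⟩ := hrank m hm
      have hsp : s ≠ p := by rintro rfl; exact hsm hpm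
      obtain ⟨n, hn, hpn, hsn⟩ := h.join (h.symm (hs p hpm))
      obtain ⟨v, hvn, hqv⟩ := h.meet hn q
      have hxv : r x v := h.all hn hpn hsn hsp.symm (h.symm x.2.1) (h.symm (hs x hxm)) hvn
      have hne : x ≠ ⟨v, h.mem hn hpn hvn, hqv⟩ := by
        intro e
        have e' : (x : P) = v := congrArg Subtype.val e
        refine hsm ?_
        rw [hunique x p hxp m hm n hn hxm hpm (e' ▸ hvn) hpn]
        exact hsn
      obtain ⟨k, hk, hk', hxk, -⟩ := join_ne x _ hne hxv
      exact ⟨_, ⟨k, hk, hk', rfl⟩, hxk, hxk⟩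
    · obtain ⟨m, hm, hm', hxm, hym⟩ := join_ne x y hne hxy
      exact ⟨_, ⟨m, hm, hm', rfl⟩, hxm, hym⟩
  · rintro _ ⟨m, hm, hm', rfl⟩ x
    obtain ⟨z, hz, hxz⟩ := h.meet hm x
    exact ⟨⟨z, hm' z hz⟩, hz, hxz⟩
  · rintro _ ⟨m, hm, hm', rfl⟩ x y z s hy hz hne hxy hxz hs
    exact h.all hm hy hz (fun e => hne (Subtype.ext e)) hxy hxz hs
  · rintro _ ⟨m, hm, hm', rfl⟩ a b c
    obtain ⟨d, hd, ha, hb, hc⟩ := h.fourth hm a b c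
    exact ⟨⟨d, hm' d hd⟩, hd, fun e => ha (congrArg Subtype.val e),
      fun e => hb (congrArg Subtype.val e), fun e => hc (congrArg Subtype.val e)⟩
  · intro x
    have hxp : p ≠ x := fun e => hpq (h.symm (e ▸ x.2.2))
    obtain ⟨z, hpz, hxz⟩ := h.exists_rel_not_rel hxp
    have hzp : z ≠ p := by rintro rfl; exact hxz (h.symm x.2.1)
    obtain ⟨v, hpv, hqv, hv⟩ := h.exists_projection hpq hpz hzp
    exact ⟨⟨v, hpv, hqv⟩, fun hr => hxz (h.symm ((hv x x.2.1).1 (h.symm hr)))⟩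

/-- There is a point of `p^⊥ ∩ q^⊥` collinear with none of three given neighbours of `p`. -/
theorem exists_perp_inter_not_rel (h : IsPolarSpace r 𝓛)
    (hunique : ∀ p q : P, p ≠ q → ∀ l₁ ∈ 𝓛, ∀ l₂ ∈ 𝓛,
      p ∈ l₁ → q ∈ l₁ → p ∈ l₂ → q ∈ l₂ → l₁ = l₂)
    (hrank : ∀ l ∈ 𝓛, ∃ p : P, p ∉ l ∧ ∀ q ∈ l, r p q) {p q : P} (hpq : ¬ r p q)
    {s₁ s₂ s₃ : P} (h₁ : r p s₁) (h₂ : r p s₂) (h₃ : r p s₃)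
    (n₁ : s₁ ≠ p) (n₂ : s₂ ≠ p) (n₃ : s₃ ≠ p) :
    ∃ u, r p u ∧ r q u ∧ ¬ r s₁ u ∧ ¬ r s₂ u ∧ ¬ r s₃ u := by
  obtain ⟨x₁, hp₁, hq₁, e₁⟩ := h.exists_projection hpq h₁ n₁
  obtain ⟨x₂, hp₂, hq₂, e₂⟩ := h.exists_projection hpq h₂ n₂
  obtain ⟨x₃, hp₃, hq₃, e₃⟩ := h.exists_projection hpq h₃ n₃
  obtain ⟨⟨u, hpu, hqu⟩, k₁, k₂, k₃⟩ := (h.perp_inter hunique hrank hpq).exists_not_rel_three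
    ⟨x₁, hp₁, hq₁⟩ ⟨x₂, hp₂, hq₂⟩ ⟨x₃, hp₃, hq₃⟩
  exact ⟨u, hpu, hqu, fun k => k₁ ((e₁ u hpu).2 k), fun k => k₂ ((e₂ u hpu).2 k),
    fun k => k₃ ((e₃ u hpu).2 k)⟩

end IsPolarSpace

/-- Lines of `𝓛` no point of which is collinear with all of `L₁` or with all of `L₂`. -/
def farLines {P : Type*} (r : P → P → Prop) (𝓛 : Set (Set P)) (L₁ L₂ : Set P) :
    Set (Set P) :=
  {J ∈ 𝓛 | ∀ p ∈ J, (¬ ∀ q ∈ L₁, r p q) ∧ ¬ ∀ q ∈ L₂, r p q}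

/-- Distinct lines of `S` that meet and are contained in a common singular subspace. -/
def LineAdj {P : Type*} (r : P → P → Prop) (S : Set (Set P)) (J K : Set P) : Prop :=
  J ∈ S ∧ K ∈ S ∧ J ≠ K ∧ (J ∩ K).Nonempty ∧ ∀ p ∈ J, ∀ q ∈ K, r p q

namespace IsPolarSpace

variable {P : Type*} {r : P → P → Prop} {𝓛 : Set (Set P)} {L₁ L₂ : Set P}

theorem not_rel_of_forall_mem (h : IsPolarSpace r 𝓛) {J L : Set P} (hJ : J ∈ 𝓛)
    (hL : L ∈ 𝓛) (hfar : ∀ p ∈ J, ¬ ∀ q ∈ L, r p q) {s : P} (hs : s ∈ L) :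
    ¬ ∀ q ∈ J, r s q := by
  intro hsJ
  obtain ⟨t, ht, hts, -, -⟩ := h.fourth hL s s s
  obtain ⟨j, hj, htj⟩ := h.meet hJ t
  exact hfar j hj fun q hq => h.all hL ht hs hts (h.symm htj) (h.symm (hsJ j hj)) hq

theorem line_mem_farLines (h : IsPolarSpace r 𝓛) {p u s₁ s₂ : P} {J : Set P}
    (hp : (¬ ∀ q ∈ L₁, r p q) ∧ ¬ ∀ q ∈ L₂, r p q) (hs₁ : s₁ ∈ L₁) (hs₂ : s₂ ∈ L₂)
    (hps₁ : r p s₁) (hps₂ : r p s₂) (hJ : J ∈ 𝓛) (hpJ : p ∈ J) (huJ : u ∈ J)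
    (hu₁ : ¬ r s₁ u) (hu₂ : ¬ r s₂ u) : J ∈ farLines r 𝓛 L₁ L₂ := by
  refine ⟨hJ, fun j hj => ⟨fun hall => ?_, fun hall => ?_⟩⟩
  · have hne : j ≠ p := by rintro rfl; exact hp.1 hall
    exact hu₁ (h.all hJ hj hpJ hne (h.symm (hall _ hs₁)) (h.symm hps₁) huJ)
  · have hne : j ≠ p := by rintro rfl; exact hp.2 hall
    exact hu₂ (h.all hJ hj hpJ hne (h.symm (hall _ hs₂)) (h.symm hps₂) huJ)

theorem not_rel_of_line_far (h : IsPolarSpace r 𝓛) {J L : Set P} (hJ : J ∈ 𝓛)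
    (hL : L ∈ 𝓛) (hfar : ∀ p ∈ J, ¬ ∀ q ∈ L, r p q) {p u s : P} (hs : s ∈ L) (hpJ : p ∈ J)
    (huJ : u ∈ J) (hup : u ≠ p) (hps : r p s) : ¬ r s u := fun hsu =>
  h.not_rel_of_forall_mem hJ hL hfar hs fun _ hq =>
    h.all hJ huJ hpJ hup hsu (h.symm hps) hq

/-- Far lines through a common point are connected. -/
theorem lineAdj_of_common_point (h : IsPolarSpace r 𝓛)
    (hunique : ∀ p q : P, p ≠ q → ∀ l₁ ∈ 𝓛, ∀ l₂ ∈ 𝓛,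
      p ∈ l₁ → q ∈ l₁ → p ∈ l₂ → q ∈ l₂ → l₁ = l₂)
    (hrank : ∀ l ∈ 𝓛, ∃ p : P, p ∉ l ∧ ∀ q ∈ l, r p q)
    (hL₁ : L₁ ∈ 𝓛) (hL₂ : L₂ ∈ 𝓛) {J K : Set P} (hJ : J ∈ farLines r 𝓛 L₁ L₂)
    (hK : K ∈ farLines r 𝓛 L₁ L₂) {p : P} (hpJ : p ∈ J) (hpK : p ∈ K) :
    Relation.ReflTransGen (LineAdj r (farLines r 𝓛 L₁ L₂)) J K := by
  obtain ⟨q, hpq⟩ := h.nondeg p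
  have hp := hJ.2 p hpJ
  obtain ⟨s₁, hs₁, hps₁⟩ := h.meet hL₁ p
  obtain ⟨s₂, hs₂, hps₂⟩ := h.meet hL₂ p
  have n₁ : s₁ ≠ p := by rintro rfl; exact hp.1 fun q hq => h.mem hL₁ hs₁ hq
  have n₂ : s₂ ≠ p := by rintro rfl; exact hp.2 fun q hq => h.mem hL₂ hs₂ hq
  obtain ⟨x₁, hp₁, hq₁, e₁⟩ := h.exists_projection hpq hps₁ n₁
  obtain ⟨x₂, hp₂, hq₂, e₂⟩ := h.exists_projection hpq hps₂ n₂
  have point : ∀ M ∈ farLines r 𝓛 L₁ L₂, p ∈ M →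
      ∃ a ∈ M, ∃ ha : r p a ∧ r q a, ¬ r x₁ a ∧ ¬ r x₂ a := by
    intro M hM hpM
    obtain ⟨a, haM, hqa⟩ := h.meet hM.1 q
    have hap : a ≠ p := by rintro rfl; exact hpq (h.symm hqa)
    have hpa := h.mem hM.1 hpM haM
    refine ⟨a, haM, ⟨hpa, hqa⟩, ?_, ?_⟩
    · rw [e₁ a hpa]
      exact h.not_rel_of_line_far hM.1 hL₁ (fun p hp => (hM.2 p hp).1) hs₁ hpM haM hap hps₁
    · rw [e₂ a hpa]
      exact h.not_rel_of_line_far hM.1 hL₂ (fun p hp => (hM.2 p hp).2) hs₂ hpM haM hap hps₂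
  have far : ∀ M ∈ 𝓛, p ∈ M → ∀ a ∈ M, (r p a ∧ r q a) → (¬ r x₁ a ∧ ¬ r x₂ a) →
      M ∈ farLines r 𝓛 L₁ L₂ := by
    intro M hM hpM a haM ha hf
    exact h.line_mem_farLines hp hs₁ hs₂ hps₁ hps₂ hM hpM haM
      (fun k => hf.1 ((e₁ a ha.1).2 k)) (fun k => hf.2 ((e₂ a ha.1).2 k))
  obtain ⟨a, haJ, ha, hfa⟩ := point J hJ hpJ
  obtain ⟨b, hbK, hb, hfb⟩ := point K hK hpK
  have path := (h.perp_inter hunique hrank hpq).farAdj_connected (x₁ := ⟨x₁, hp₁, hq₁⟩)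
    (x₂ := ⟨x₂, hp₂, hq₂⟩) (a := ⟨a, ha⟩) (b := ⟨b, hb⟩) hfa hfb
  suffices H : ∀ z : {x : P // r p x ∧ r q x}, Relation.ReflTransGen (FarAdj
      (fun x y : {x : P // r p x ∧ r q x} => r x y) ⟨x₁, hp₁, hq₁⟩ ⟨x₂, hp₂, hq₂⟩) ⟨a, ha⟩ z →
      ∀ M ∈ 𝓛, p ∈ M → (z : P) ∈ M →
      Relation.ReflTransGen (LineAdj r (farLines r 𝓛 L₁ L₂)) J M from
    H _ path K hK.1 hpK hbK
  intro z hz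
  induction hz with
  | refl =>
    intro M hM hpM haM
    have hap : a ≠ p := by rintro rfl; exact hpq (h.symm ha.2)
    rw [hunique a p hap J hJ.1 M hM haJ hpJ haM hpM]
  | @tail y z _ hyz ih =>
    intro M hM hpM hzM
    obtain ⟨N, hN, hpN, hyN⟩ := h.join y.2.1
    have hyp : (y : P) ≠ p := fun e => hpq (h.symm (e ▸ y.2.2))
    have hzp : (z : P) ≠ p := fun e => hpq (h.symm (e ▸ z.2.2))
    refine (ih N hN hpN hyN).tail ⟨far N hN hpN y hyN y.2 hyz.2.2.1,
      far M hM hpM z hzM z.2 hyz.2.2.2, ?_, ⟨p, hpN, hpM⟩, ?_⟩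
    · rintro rfl
      refine hpq (h.symm (h.all hN hyN hzM (fun e => hyz.1 (Subtype.ext e)) y.2.2 z.2.2 hpN))
    · have hzN : ∀ s ∈ N, r z s := fun s hs =>
        h.all hN hyN hpN hyp (h.symm hyz.2.1) (h.symm z.2.1) hs
      exact fun s hs t ht => h.all hM hzM hpM hzp (h.symm (hzN s hs)) (h.mem hN hs hpN) ht

/-- Far lines with noncollinear points are connected. -/
theorem lineAdj_of_not_rel (h : IsPolarSpace r 𝓛)
    (hunique : ∀ p q : P, p ≠ q → ∀ l₁ ∈ 𝓛, ∀ l₂ ∈ 𝓛,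
      p ∈ l₁ → q ∈ l₁ → p ∈ l₂ → q ∈ l₂ → l₁ = l₂)
    (hrank : ∀ l ∈ 𝓛, ∃ p : P, p ∉ l ∧ ∀ q ∈ l, r p q)
    (hL₁ : L₁ ∈ 𝓛) (hL₂ : L₂ ∈ 𝓛) {J K : Set P} (hJ : J ∈ farLines r 𝓛 L₁ L₂)
    (hK : K ∈ farLines r 𝓛 L₁ L₂) {p t : P} (hpJ : p ∈ J) (htK : t ∈ K) (hpt : ¬ r p t) :
    Relation.ReflTransGen (LineAdj r (farLines r 𝓛 L₁ L₂)) J K := by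
  have conn : ∀ {M N : Set P}, M ∈ farLines r 𝓛 L₁ L₂ → N ∈ farLines r 𝓛 L₁ L₂ →
      ∀ {x : P}, x ∈ M → x ∈ N →
      Relation.ReflTransGen (LineAdj r (farLines r 𝓛 L₁ L₂)) M N := fun hM hN _ hxM hxN =>
    h.lineAdj_of_common_point hunique hrank hL₁ hL₂ hM hN hxM hxN
  have ne₁ : ∀ {M : Set P}, M ∈ farLines r 𝓛 L₁ L₂ → ∀ {x s : P}, x ∈ M → s ∈ L₁ → s ≠ x := by
    rintro M hM x s hx hs rfl
    exact (hM.2 _ hx).1 fun q hq => h.mem hL₁ hs hq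
  have ne₂ : ∀ {M : Set P}, M ∈ farLines r 𝓛 L₁ L₂ → ∀ {x s : P}, x ∈ M → s ∈ L₂ → s ≠ x := by
    rintro M hM x s hx hs rfl
    exact (hM.2 _ hx).2 fun q hq => h.mem hL₂ hs hq
  have htp : ¬ r t p := fun k => hpt (h.symm k)
  obtain ⟨p₁, hp₁, hpp₁⟩ := h.meet hL₁ p
  obtain ⟨p₂, hp₂, hpp₂⟩ := h.meet hL₂ p
  obtain ⟨t₁, ht₁, htt₁⟩ := h.meet hL₁ t
  obtain ⟨t₂, ht₂, htt₂⟩ := h.meet hL₂ t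
  obtain ⟨y₁, hty₁, hpy₁, e₁⟩ := h.exists_projection htp htt₁ (ne₁ hK htK ht₁)
  have hy₁p : y₁ ≠ p := by rintro rfl; exact htp hty₁
  obtain ⟨u, hpu, htu, hu₁, hu₂, hu₃⟩ := h.exists_perp_inter_not_rel hunique hrank hpt
    hpp₁ hpp₂ hpy₁ (ne₁ hJ hpJ hp₁) (ne₂ hJ hpJ hp₂) hy₁p
  rw [e₁ u htu] at hu₃
  obtain ⟨M, hM, hpM, huM⟩ := h.join hpu
  have hM' := h.line_mem_farLines (hJ.2 p hpJ) hp₁ hp₂ hpp₁ hpp₂ hM hpM huM hu₁ hu₂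
  obtain ⟨q, hqM, htq⟩ := h.meet hM t₁
  have hqu : q ≠ u := by rintro rfl; exact hu₃ htq
  have hntq : ¬ r t q := fun k => htp (h.all hM hqM huM hqu k htu hpM)
  obtain ⟨q₂, hq₂, hqq₂⟩ := h.meet hL₂ q
  obtain ⟨y₂, hty₂, hqy₂, e₂⟩ := h.exists_projection hntq htt₂ (ne₂ hK htK ht₂)
  have hy₂q : y₂ ≠ q := by rintro rfl; exact hntq hty₂
  obtain ⟨v, hqv, htv, hv₁, hv₂, hv₃⟩ := h.exists_perp_inter_not_rel hunique hrank
    (fun k => hntq (h.symm k)) (h.symm htq) hqq₂ hqy₂ (ne₁ hM' hqM ht₁) (ne₂ hM' hqM hq₂) hy₂q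
  rw [e₂ v htv] at hv₃
  obtain ⟨N, hN, hqN, hvN⟩ := h.join hqv
  obtain ⟨O, hO, htO, hvO⟩ := h.join htv
  have hN' := h.line_mem_farLines (hM'.2 q hqM) ht₁ hq₂ (h.symm htq) hqq₂ hN hqN hvN hv₁ hv₂
  have hO' := h.line_mem_farLines (hK.2 t htK) ht₁ ht₂ htt₁ htt₂ hO htO hvO hv₁ hv₃
  exact (((conn hJ hM' hpJ hpM).trans (conn hM' hN' hqM hqN)).trans
    (conn hN' hO' hvN hvO)).trans (conn hO' hK htO htK)

theorem lineAdj_connected (h : IsPolarSpace r 𝓛)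
    (hunique : ∀ p q : P, p ≠ q → ∀ l₁ ∈ 𝓛, ∀ l₂ ∈ 𝓛,
      p ∈ l₁ → q ∈ l₁ → p ∈ l₂ → q ∈ l₂ → l₁ = l₂)
    (hrank : ∀ l ∈ 𝓛, ∃ p : P, p ∉ l ∧ ∀ q ∈ l, r p q)
    (hL₁ : L₁ ∈ 𝓛) (hL₂ : L₂ ∈ 𝓛) {J K : Set P} (hJ : J ∈ farLines r 𝓛 L₁ L₂)
    (hK : K ∈ farLines r 𝓛 L₁ L₂) :
    Relation.ReflTransGen (LineAdj r (farLines r 𝓛 L₁ L₂)) J K := by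
  obtain ⟨p₀, -⟩ := hrank J hJ.1
  obtain ⟨t, htK, -⟩ := h.meet hK.1 p₀
  obtain ⟨p, hpJ, hpt, -, -⟩ := h.fourth hJ.1 t t t
  by_cases hr : r p t
  · obtain ⟨q, hpq⟩ := h.nondeg p
    obtain ⟨p₁, hp₁, hpp₁⟩ := h.meet hL₁ p
    obtain ⟨p₂, hp₂, hpp₂⟩ := h.meet hL₂ p
    have hp := hJ.2 p hpJ
    have n₁ : p₁ ≠ p := by rintro rfl; exact hp.1 fun q hq => h.mem hL₁ hp₁ hq
    have n₂ : p₂ ≠ p := by rintro rfl; exact hp.2 fun q hq => h.mem hL₂ hp₂ hq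
    obtain ⟨u, hpu, -, hu₁, hu₂, hu₃⟩ := h.exists_perp_inter_not_rel hunique hrank hpq
      hpp₁ hpp₂ hr n₁ n₂ hpt.symm
    obtain ⟨M, hM, hpM, huM⟩ := h.join hpu
    have hM' := h.line_mem_farLines hp hp₁ hp₂ hpp₁ hpp₂ hM hpM huM hu₁ hu₂
    exact (h.lineAdj_of_common_point hunique hrank hL₁ hL₂ hJ hM' hpJ hpM).trans
      (h.lineAdj_of_not_rel hunique hrank hL₁ hL₂ hM' hK huM htK fun k => hu₃ (h.symm k))
  · exact h.lineAdj_of_not_rel hunique hrank hL₁ hL₂ hJ hK hpJ htK hr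

end IsPolarSpace

/-- Joined elements are joined by a finite sequence. -/
theorem Relation.ReflTransGen.exists_sequence {α : Type*} {R : α → α → Prop} {a b : α}
    (h : Relation.ReflTransGen R a b) :
    ∃ (n : ℕ) (f : ℕ → α), f 0 = a ∧ f n = b ∧ ∀ i < n, R (f i) (f (i + 1)) := by
  induction h using Relation.ReflTransGen.head_induction_on with
  | refl => exact ⟨0, fun _ => b, rfl, rfl, by simp⟩
  | @head a c hac _ ih =>
    obtain ⟨n, f, h0, hn, hf⟩ := ih
    refine ⟨n + 1, fun i => Nat.casesOn i a f, rfl, hn, fun i hi => ?_⟩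
    cases i with
    | zero => simpa [h0] using hac
    | succ i => exact hf i (by omega)

/-- In a thick polar space of rank at least `3` with at least `4` points
per line, the set `S` of lines opposite two given lines `L₁, L₂` is connected under the
adjacency relation "distinct, meeting in a point, spanning a common singular plane". -/
theorem polar_space_lines_opposite_two_lines_connected
    {P : Type*} (𝓛 : Set (Set P))
    -- thick polar space of rank at least 3: axioms
    (hline3 : ∀ l ∈ 𝓛, 3 ≤ l.encard)
    (hunique : ∀ p q : P, p ≠ q → ∀ l₁ ∈ 𝓛, ∀ l₂ ∈ 𝓛,
      p ∈ l₁ → q ∈ l₁ → p ∈ l₂ → q ∈ l₂ → l₁ = l₂)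
    (hpointline : ∀ p : P, ∃ l ∈ 𝓛, p ∈ l)
    (hBS : ∀ p : P, ∀ l ∈ 𝓛, p ∉ l →
      (∃! q : P, q ∈ l ∧ GeomCollinear 𝓛 p q) ∨ (∀ q ∈ l, GeomCollinear 𝓛 p q))
    (hnondeg : ∀ p : P, ∃ q : P, ¬ GeomCollinear 𝓛 p q)
    (hrank3 : ∀ l ∈ 𝓛, ∃ p : P, p ∉ l ∧ ∀ q ∈ l, GeomCollinear 𝓛 p q)
    -- every line contains at least 4 points
    (hline4 : ∀ l ∈ 𝓛, 4 ≤ l.encard)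
    (L₁ L₂ : Set P) (hL₁ : L₁ ∈ 𝓛) (hL₂ : L₂ ∈ 𝓛)
    (S : Set (Set P))
    (hS : S = {J ∈ 𝓛 | OppositeLines 𝓛 J L₁ ∧ OppositeLines 𝓛 J L₂}) :
    ∀ J ∈ S, ∀ J' ∈ S, ∃ (n : ℕ) (Js : ℕ → Set P),
      Js 0 = J ∧ Js n = J' ∧ (∀ i ≤ n, Js i ∈ S) ∧
      ∀ i < n, Js i ≠ Js (i + 1) ∧ (Js i ∩ Js (i + 1)).Nonempty ∧
        ∀ p ∈ Js i, ∀ q ∈ Js (i + 1), GeomCollinear 𝓛 p q := by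
  have h : IsPolarSpace (GeomCollinear 𝓛) 𝓛 := by
    have hrefl : ∀ x, GeomCollinear 𝓛 x x := fun x => by
      obtain ⟨l, hl, hx⟩ := hpointline x
      exact ⟨l, hl, hx, hx⟩
    refine ⟨hrefl, fun ⟨l, hl, hx, hy⟩ => ⟨l, hl, hy, hx⟩, fun hl _ _ hx hy => ⟨_, hl, hx, hy⟩,
      id, ?_, ?_, ?_, hnondeg⟩
    · intro l hl x
      by_cases hx : x ∈ l
      · exact ⟨x, hx, hrefl x⟩
      rcases hBS x l hl hx with ⟨q, hq, -⟩ | hall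
      · exact ⟨q, hq⟩
      · have hne : l.Nonempty := by
          rw [← Set.encard_pos]
          exact lt_of_lt_of_le (by norm_num) (hline3 l hl)
        exact ⟨_, hne.some_mem, hall _ hne.some_mem⟩
    · intro l hl x p q s hp hq hne hxp hxq hs
      by_cases hx : x ∈ l
      · exact ⟨l, hl, hx, hs⟩
      rcases hBS x l hl hx with ⟨w, -, hw⟩ | hall
      · exact absurd ((hw p ⟨hp, hxp⟩).trans (hw q ⟨hq, hxq⟩).symm) hne
      · exact hall s hs
    · intro l hl a b c
      by_contra! hcon
      have hsub : l ⊆ {a, b, c} := by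
        intro d hd
        by_cases h₁ : d = a
        · simp [h₁]
        by_cases h₂ : d = b
        · simp [h₂]
        simp [hcon d hd h₁ h₂]
      have hcard : ({a, b, c} : Set P).encard ≤ 3 := by
        calc ({a, b, c} : Set P).encard ≤ ({b, c} : Set P).encard + 1 := Set.encard_insert_le _ _
          _ ≤ ({c} : Set P).encard + 1 + 1 := by gcongr; exact Set.encard_insert_le _ _
          _ = 3 := by rw [Set.encard_singleton]; norm_num
      exact absurd ((hline4 l hl).trans ((Set.encard_le_encard hsub).trans hcard)) (by norm_num)
  have hSfar : S = farLines (GeomCollinear 𝓛) 𝓛 L₁ L₂ := by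
    rw [hS]
    ext J
    constructor
    · rintro ⟨hJ, h₁, h₂⟩
      exact ⟨hJ, fun p hp => ⟨h₁.1 p hp, h₂.1 p hp⟩⟩
    · rintro ⟨hJ, hf⟩
      exact ⟨hJ, ⟨fun p hp => (hf p hp).1, fun _ hp =>
          h.not_rel_of_forall_mem hJ hL₁ (fun p hp => (hf p hp).1) hp⟩,
        ⟨fun p hp => (hf p hp).2, fun _ hp =>
          h.not_rel_of_forall_mem hJ hL₂ (fun p hp => (hf p hp).2) hp⟩⟩
  rw [hSfar]
  intro J hJ J' hJ'
  obtain ⟨n, f, h0, hn, hf⟩ :=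
    (h.lineAdj_connected hunique hrank3 hL₁ hL₂ hJ hJ').exists_sequence
  refine ⟨n, f, h0, hn, fun i hi => ?_, fun i hi => (hf i hi).2.2⟩
  rcases hi.lt_or_eq with hlt | rfl
  · exact (hf i hlt).1
  · rwa [hn]
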